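/- Let G be a finite bipartite graph with parts V1 and V2 such that V1 is nonempty. Then 2·δ_loc(G) ≤ |V1| + log₂(|V1|) + 1. -/

import Mathlib

open Finset

open Classical in
/-- The odd-neighbourhood of `D` in `G`: vertices having an odd number of neighbours in `D`. -/
noncomputable def oddNbhd {V : Type*} [Fintype V] (G : SimpleGraph V) (D : Finset V) :
    Finset V :=
  Finset.univ.filter fun v => Odd ((D.filter fun u => G.Adj v u).card)

/-- At most half of the subsets of `S` contain an odd number of elements satisfying `p`. -/
lemma two_mul_card_powerset_filter_odd_le {V : Type*} [DecidableEq V] (S : Finset V)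
    (p : V → Prop) [DecidablePred p] :
    2 * (S.powerset.filter fun D => Odd (D.filter p).card).card ≤ 2 ^ S.card := by
  have htot := S.powerset.card_filter_add_card_filter_not fun D => Odd (D.filter p).card
  rw [card_powerset] at htot
  suffices h : (S.powerset.filter fun D => Odd (D.filter p).card).card ≤
      (S.powerset.filter fun D => ¬ Odd (D.filter p).card).card by omega
  by_cases hu : ∃ u ∈ S, p u
  · obtain ⟨u, hu, hpu⟩ := hu
    refine card_le_card_of_injOn (fun D => symmDiff D {u}) ?_
      ((symmDiff_left_injective {u}).injOn)
    intro D hD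
    simp only [coe_filter, mem_powerset, Set.mem_ofPred_eq] at hD ⊢
    by_cases hmem : u ∈ D
    · have heq : symmDiff D {u} = D.erase u := by
        ext x; simp only [mem_symmDiff, mem_singleton, mem_erase]; grind
      have hcard := card_erase_add_one (mem_filter.2 ⟨hmem, hpu⟩)
      rw [heq, filter_erase]
      refine ⟨(erase_subset _ _).trans hD.1, ?_⟩
      have := hD.2
      rw [← hcard] at this
      grind
    · have heq : symmDiff D {u} = insert u D := by
        ext x; simp only [mem_symmDiff, mem_singleton, mem_insert]; grind
      rw [heq, filter_insert, if_pos hpu, card_insert_of_notMem (by simp [hmem])]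
      refine ⟨insert_subset hu hD.1, ?_⟩
      have := hD.2
      grind
  · push Not at hu
    rw [filter_eq_empty_iff.2]
    · simp
    · intro D hD
      rw [filter_eq_empty_iff.2 fun x hx => hu x (mem_powerset.1 hD hx)]
      simp

/-- Averaging `|D ∪ Odd_G(D)|` over the nonempty subsets `D` of a set `S` of vertices all of whose
neighbours lie in a set `W` disjoint from `S`. -/
lemma two_mul_le_of_forall_le_card_union_oddNbhd {V : Type*} [Fintype V] [DecidableEq V]
    (G : SimpleGraph V) {S W : Finset V} (hdisj : Disjoint S W)
    (hadj : ∀ u v : V, G.Adj u v → v ∈ S → u ∈ W) {d : ℕ}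
    (hd : ∀ D : Finset V, D.Nonempty → d ≤ (D ∪ oddNbhd G D).card) :
    2 * ((2 ^ S.card - 1) * d) ≤ (S.card + W.card) * 2 ^ S.card := by
  classical
  have hodd : ∀ D ⊆ S, oddNbhd G D ⊆ W := by
    intro D hD v hv
    obtain ⟨u, hu⟩ := card_pos.1 (mem_filter.1 hv).2.pos
    exact hadj v u (mem_filter.1 hu).2 (hD (mem_filter.1 hu).1)
  have hlower : (2 ^ S.card - 1) * d ≤ ∑ D ∈ S.powerset, (D ∪ oddNbhd G D).card := by
    calc (2 ^ S.card - 1) * d = ∑ D ∈ S.powerset.erase ∅, d := by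
          rw [sum_const, card_erase_of_mem (empty_mem_powerset S), card_powerset, smul_eq_mul]
      _ ≤ ∑ D ∈ S.powerset.erase ∅, (D ∪ oddNbhd G D).card :=
          sum_le_sum fun D hD => hd D (nonempty_iff_ne_empty.2 (mem_erase.1 hD).1)
      _ ≤ _ := sum_le_sum_of_subset (erase_subset _ _)
  have hswap : ∑ D ∈ S.powerset, (D ∪ oddNbhd G D).card =
      ∑ w ∈ S ∪ W, (S.powerset.filter fun D => w ∈ D ∪ oddNbhd G D).card := by
    refine Eq.trans (sum_congr rfl fun D hD => ?_)
      (sum_card_bipartiteAbove_eq_sum_card_bipartiteBelow fun D w => w ∈ D ∪ oddNbhd G D)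
    have hsub := union_subset_union (mem_powerset.1 hD) (hodd D (mem_powerset.1 hD))
    rw [bipartiteAbove, filter_mem_eq_inter, inter_eq_right.2 hsub]
  have hhalf : ∀ w ∈ S ∪ W,
      2 * (S.powerset.filter fun D => w ∈ D ∪ oddNbhd G D).card ≤ 2 ^ S.card := by
    intro w hw
    rcases mem_union.1 hw with hw | hw
    · refine le_trans (Nat.mul_le_mul_left 2 (card_le_card ?_))
        (two_mul_card_powerset_filter_odd_le S (· = w))
      intro D hD
      obtain ⟨hDS, hwD⟩ := mem_filter.1 hD
      have hwD : w ∈ D := (mem_union.1 hwD).resolve_right fun h =>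
        disjoint_left.1 hdisj hw (hodd D (mem_powerset.1 hDS) h)
      refine mem_filter.2 ⟨hDS, ?_⟩
      rw [filter_eq', if_pos hwD]
      simp
    · refine le_trans (Nat.mul_le_mul_left 2 (card_le_card ?_))
        (two_mul_card_powerset_filter_odd_le S (G.Adj w))
      intro D hD
      obtain ⟨hDS, hwD⟩ := mem_filter.1 hD
      have hwD := (mem_union.1 hwD).resolve_left fun h =>
        disjoint_left.1 hdisj (mem_powerset.1 hDS h) hw
      exact mem_filter.2 ⟨hDS, by convert (mem_filter.1 hwD).2⟩
  calc 2 * ((2 ^ S.card - 1) * d) ≤ 2 * ∑ D ∈ S.powerset, (D ∪ oddNbhd G D).card := by gcongr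
    _ = ∑ w ∈ S ∪ W, 2 * (S.powerset.filter fun D => w ∈ D ∪ oddNbhd G D).card := by
        rw [hswap, mul_sum]
    _ ≤ ∑ w ∈ S ∪ W, 2 ^ S.card := sum_le_sum hhalf
    _ = _ := by rw [sum_const, card_union_of_disjoint hdisj, smul_eq_mul]

/-- For a finite bipartite graph `G` with parts `V1`, `V2` and `V1` nonempty,
`2 δ_loc(G) ≤ |V1| + log₂|V1| + 1`, where
`δ_loc(G) + 1 = min_{∅ ≠ D ⊆ V} |D ∪ Odd_G(D)|`. -/
theorem two_dloc_le_side_bound {V : Type*} [Fintype V] [DecidableEq V]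
    (G : SimpleGraph V)
    (V1 V2 : Finset V) (hdisj : Disjoint V1 V2) (hcover : V1 ∪ V2 = Finset.univ)
    (hbip : ∀ u v : V, G.Adj u v → (u ∈ V1 ∧ v ∈ V2) ∨ (u ∈ V2 ∧ v ∈ V1))
    (hV1 : V1.Nonempty) (dloc : ℕ)
    (hd : dloc + 1 = sInf {m : ℕ | ∃ D : Finset V, D.Nonempty ∧ (D ∪ oddNbhd G D).card = m}) :
    2 * (dloc : ℝ) ≤ (V1.card : ℝ) + Real.logb 2 (V1.card : ℝ) + 1 := by
  classical
  have hmin : ∀ D : Finset V, D.Nonempty → dloc + 1 ≤ (D ∪ oddNbhd G D).card :=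
    fun D hD => hd ▸ Nat.sInf_le ⟨D, hD, rfl⟩
  have hn : V1.card ≠ 0 := hV1.card_ne_zero
  have hlog : (Nat.log 2 V1.card : ℝ) ≤ Real.logb 2 V1.card := by
    exact_mod_cast Real.natLog_le_logb V1.card 2
  suffices h : 2 * dloc ≤ V1.card + (Nat.log 2 V1.card + 1) by
    have h' : 2 * (dloc : ℝ) ≤ V1.card + (Nat.log 2 V1.card + 1) := by exact_mod_cast h
    linarith
  have hlt : V1.card < 2 ^ (Nat.log 2 V1.card + 1) := Nat.lt_pow_succ_log_self one_lt_two _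
  by_cases hm : Nat.log 2 V1.card + 1 ≤ V2.card
  · obtain ⟨S, hS, hcard⟩ := exists_subset_card_eq hm
    have key := two_mul_le_of_forall_le_card_union_oddNbhd G
      (hdisj.symm.mono_left hS)
      (fun u v huv hv => ((hbip u v huv).resolve_right fun h =>
        disjoint_left.1 hdisj h.2 (hS hv)).1) hmin
    rw [hcard] at key
    generalize Nat.log 2 V1.card + 1 = k at *
    have hk : k + 1 ≤ 2 ^ k := Nat.lt_two_pow_self
    obtain ⟨q, hq⟩ : ∃ q, 2 ^ k = q + 1 := ⟨2 ^ k - 1, by omega⟩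
    rw [hq] at key hlt hk
    rw [Nat.add_sub_cancel] at key
    by_contra! hcon
    have : 3 * q ≤ k + V1.card := by nlinarith [Nat.mul_le_mul_left q hcon]
    omega
  · obtain ⟨v, hv⟩ := hV1
    have hsub : {v} ∪ oddNbhd G {v} ⊆ insert v V2 := by
      intro w hw
      rcases mem_union.1 hw with hw | hw
      · exact mem_insert.2 (Or.inl (mem_singleton.1 hw))
      · obtain ⟨u, hu⟩ := card_pos.1 (mem_filter.1 hw).2.pos
        obtain ⟨hu, hadj⟩ := mem_filter.1 hu
        rw [mem_singleton.1 hu] at hadj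
        exact mem_insert_of_mem ((hbip w v hadj).resolve_left fun h =>
          disjoint_left.1 hdisj hv h.2).1
    have := (hmin {v} (singleton_nonempty v)).trans
      ((card_le_card hsub).trans (card_insert_le v V2))
    have := Nat.log_le_self 2 V1.card
    omega
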